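/- Suppose the right action of G on Γ is transitive, and fix γ₀ ∈ Γ with stabilizer H = {g ∈ G : γ₀·g = γ₀}. Then the map h ↦ h^{γ₀} is an injective group homomorphism from H into the derived group G_ρ, and G_ρ is isomorphic to the free product of H with a free group on the set Γ∖{γ₀}. -/

import Mathlib

/-- The defining relators of Crowell's derived group of the permutation
representation associated to a right action `act` of `G` on `Γ`:
`(γ, g*h) * ((γ, g) * (γ·g, h))⁻¹` for `g, h ∈ G` and `γ ∈ Γ`. -/
def derivedRels {Γ : Type*} {G : Type*} [Group G] (act : Γ → G → Γ) :
    Set (FreeGroup (Γ × G)) :=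
  {r | ∃ (γ : Γ) (g h : G),
    r = FreeGroup.of (γ, g * h) *
      (FreeGroup.of (γ, g) * FreeGroup.of (act γ g, h))⁻¹}

/-- Crowell's derived group `G_ρ`. -/
def DerivedGroup {Γ : Type*} {G : Type*} [Group G] (act : Γ → G → Γ) :=
  PresentedGroup (derivedRels act)

instance {Γ : Type*} {G : Type*} [Group G] (act : Γ → G → Γ) :
    Group (DerivedGroup act) :=
  inferInstanceAs (Group (PresentedGroup (derivedRels act)))

/-- The generator `g^γ` of the derived group. -/
def derivedGen {Γ : Type*} {G : Type*} [Group G] (act : Γ → G → Γ)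
    (γ : Γ) (g : G) : DerivedGroup act :=
  PresentedGroup.of (rels := derivedRels act) (γ, g)

section DerivedGroup

variable {Γ : Type*} {G : Type*} [Group G] {act : Γ → G → Γ}

theorem derivedGen_mul (γ : Γ) (g h : G) :
    derivedGen act γ (g * h) = derivedGen act γ g * derivedGen act (act γ g) h :=
  PresentedGroup.mk_eq_mk_of_mul_inv_mem (rels := derivedRels act) ⟨γ, g, h, rfl⟩

theorem derivedGen_one (act_one : ∀ γ : Γ, act γ 1 = γ) (γ : Γ) : derivedGen act γ 1 = 1 := by
  have h := derivedGen_mul (act := act) γ 1 1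
  rwa [act_one, mul_one, left_eq_mul] at h

/-- The homomorphism out of the derived group given by a crossed family of elements. -/
def DerivedGroup.lift {K : Type*} [Group K] (f : Γ → G → K)
    (hf : ∀ γ g h, f γ (g * h) = f γ g * f (act γ g) h) : DerivedGroup act →* K :=
  PresentedGroup.toGroup (rels := derivedRels act) (f := fun p => f p.1 p.2) <| by
    rintro _ ⟨γ, g, h, rfl⟩
    simp only [map_mul, map_inv, FreeGroup.lift_apply_of, hf, mul_inv_cancel]

theorem DerivedGroup.lift_derivedGen {K : Type*} [Group K] (f : Γ → G → K)
    (hf : ∀ γ g h, f γ (g * h) = f γ g * f (act γ g) h) (γ : Γ) (g : G) :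
    DerivedGroup.lift f hf (derivedGen act γ g) = f γ g :=
  PresentedGroup.toGroup.of (rels := derivedRels act) _

theorem DerivedGroup.hom_ext {K : Type*} [Group K] {φ ψ : DerivedGroup act →* K}
    (h : ∀ γ g, φ (derivedGen act γ g) = ψ (derivedGen act γ g)) : φ = ψ :=
  PresentedGroup.ext (rels := derivedRels act) fun x => h x.1 x.2

/-- A pointed action admits a transversal which is trivial at the base point. -/
theorem exists_transversal (act_one : ∀ γ : Γ, act γ 1 = γ) (γ₀ : Γ)
    (htrans : ∀ γ : Γ, ∃ g : G, act γ₀ g = γ) :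
    ∃ t : Γ → G, t γ₀ = 1 ∧ ∀ γ, act γ₀ (t γ) = γ := by
  classical
  choose t ht using htrans
  refine ⟨Function.update t γ₀ 1, Function.update_self .., fun γ => ?_⟩
  obtain rfl | hγ := eq_or_ne γ γ₀
  · rw [Function.update_self, act_one]
  · rw [Function.update_of_ne hγ, ht]

end DerivedGroup

/-- If the action is transitive with stabilizer `H` at `γ₀`, then `h ↦ h^{γ₀}`
is an injective homomorphism of `H` into the derived group, and the derived
group is the free product of `H` and a free group on `Γ ∖ {γ₀}`. -/
theorem derived_transitive_free_product {Γ : Type*} {G : Type*} [Group G] [Nonempty Γ]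
    (act : Γ → G → Γ)
    (act_one : ∀ γ : Γ, act γ 1 = γ)
    (act_mul : ∀ (γ : Γ) (g h : G), act γ (g * h) = act (act γ g) h)
    (htrans : ∀ γ γ' : Γ, ∃ g : G, act γ g = γ')
    (γ₀ : Γ) (H : Subgroup G) (hH : ∀ g : G, g ∈ H ↔ act γ₀ g = γ₀) :
    (∀ h₁ h₂ : H, derivedGen act γ₀ ((h₁ : G) * (h₂ : G))
        = derivedGen act γ₀ (h₁ : G) * derivedGen act γ₀ (h₂ : G)) ∧
    Function.Injective (fun h : H => derivedGen act γ₀ (h : G)) ∧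
    Nonempty (DerivedGroup act ≃* Monoid.Coprod H (FreeGroup {γ : Γ // γ ≠ γ₀})) := by
  classical
  obtain ⟨t, ht₀, ht⟩ := exists_transversal act_one γ₀ (htrans γ₀)
  have act_inv (γ : Γ) : act γ (t γ)⁻¹ = γ₀ := by
    nth_rw 1 [← ht γ]
    rw [← act_mul, mul_inv_cancel, act_one]
  have hmem (γ : Γ) (g : G) : t γ * g * (t (act γ g))⁻¹ ∈ H := by
    rw [hH, act_mul, act_mul, ht, act_inv]
  have hmul (h₁ h₂ : H) : derivedGen act γ₀ ((h₁ : G) * (h₂ : G))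
      = derivedGen act γ₀ (h₁ : G) * derivedGen act γ₀ (h₂ : G) := by
    rw [derivedGen_mul, (hH _).1 h₁.2]
  let u : Γ → Monoid.Coprod H (FreeGroup {γ : Γ // γ ≠ γ₀}) := fun γ =>
    if hγ : γ = γ₀ then 1 else Monoid.Coprod.inr (FreeGroup.of ⟨γ, hγ⟩)
  have hu₀ : u γ₀ = 1 := dif_pos rfl
  have hu (γ : {γ : Γ // γ ≠ γ₀}) : u γ = Monoid.Coprod.inr (FreeGroup.of γ) := dif_neg γ.2
  let F : DerivedGroup act →* Monoid.Coprod H (FreeGroup {γ : Γ // γ ≠ γ₀}) :=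
    DerivedGroup.lift
      (fun γ g => (u γ)⁻¹ * Monoid.Coprod.inl (⟨_, hmem γ g⟩ : H) * u (act γ g)) <| by
      intro γ g h
      have key : (⟨_, hmem γ (g * h)⟩ : H) = ⟨_, hmem γ g⟩ * ⟨_, hmem (act γ g) h⟩ := by
        ext
        simp only [Subgroup.coe_mul, act_mul]
        group
      rw [key, map_mul, act_mul]
      group
  have hF (γ : Γ) (g : G) : F (derivedGen act γ g) =
      (u γ)⁻¹ * Monoid.Coprod.inl (⟨_, hmem γ g⟩ : H) * u (act γ g) :=
    DerivedGroup.lift_derivedGen ..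
  have hF_stab (h : H) : F (derivedGen act γ₀ h) = Monoid.Coprod.inl h := by
    have key : (⟨_, hmem γ₀ h⟩ : H) = h := by
      ext
      simp only [(hH _).1 h.2, ht₀, one_mul, inv_one, mul_one]
    rw [hF, key, (hH _).1 h.2, hu₀, inv_one, one_mul, mul_one]
  have hF_transversal (γ : Γ) : F (derivedGen act γ₀ (t γ)) = u γ := by
    have key : (⟨_, hmem γ₀ (t γ)⟩ : H) = 1 := by
      ext
      simp only [ht, ht₀, one_mul, mul_inv_cancel, Subgroup.coe_one]
    rw [hF, key, ht, hu₀, map_one, inv_one, one_mul, one_mul]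
  let B : Monoid.Coprod H (FreeGroup {γ : Γ // γ ≠ γ₀}) →* DerivedGroup act :=
    Monoid.Coprod.lift (MonoidHom.mk' (fun h : H => derivedGen act γ₀ (h : G)) hmul)
      (FreeGroup.lift fun γ => derivedGen act γ₀ (t γ))
  have hB_inl (h : H) : B (Monoid.Coprod.inl h) = derivedGen act γ₀ h :=
    Monoid.Coprod.lift_apply_inl ..
  have hB_inr (γ : {γ : Γ // γ ≠ γ₀}) :
      B (Monoid.Coprod.inr (FreeGroup.of γ)) = derivedGen act γ₀ (t γ) := by
    rw [Monoid.Coprod.lift_apply_inr, FreeGroup.lift_apply_of]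
  have hB_u (γ : Γ) : B (u γ) = derivedGen act γ₀ (t γ) := by
    obtain rfl | hγ := eq_or_ne γ γ₀
    · rw [hu₀, map_one, ht₀, derivedGen_one act_one]
    · rw [hu ⟨γ, hγ⟩, hB_inr]
  refine ⟨hmul, fun h₁ h₂ h => ?_, ⟨F.toMulEquiv B ?_ ?_⟩⟩
  · apply Monoid.Coprod.inl_injective (N := FreeGroup {γ : Γ // γ ≠ γ₀})
    rw [← hF_stab, ← hF_stab]
    exact congrArg F h
  · refine DerivedGroup.hom_ext fun γ g => ?_
    have key := derivedGen_mul (act := act) γ₀ (t γ * g * (t (act γ g))⁻¹) (t (act γ g))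
    rw [(hH _).1 (hmem γ g), inv_mul_cancel_right, derivedGen_mul, ht] at key
    rw [MonoidHom.comp_apply, hF, map_mul, map_mul, map_inv, hB_u, hB_u, hB_inl, mul_assoc,
      ← key, inv_mul_cancel_left, MonoidHom.id_apply]
  · refine Monoid.Coprod.hom_ext ?_ ?_
    · ext h
      simp only [MonoidHom.comp_apply, hB_inl, hF_stab, MonoidHom.id_apply]
    · ext γ
      simp only [MonoidHom.comp_apply, hB_inr, hF_transversal, hu, MonoidHom.id_apply]
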